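/- arXiv:math/0410218 — 2 statements merged into one kernel-verified Lean document; each statement's English description precedes it below -/
import Mathlib

section
/- Let r ≥ 2 be an integer, let G be a simple graph with n vertices and m edges, and let v_1, …, v_r be a 𝔓-sequence of r terms in G. Writing S = Σ_{i=1}^{r} d(v_i), one has 2m ≤ n·S − Σ_{i=1}^{r} d(v_i)² + d(v_r)·(S − (r−1)·n). -/
open Finset

/-- The number of edges of a simple graph. -/
noncomputable def edgeCount {V : Type*} (G : SimpleGraph V) : ℕ := Nat.card G.edgeSet

/-- The degree of a vertex. -/
noncomputable def deg {V : Type*} (G : SimpleGraph V) (u : V) : ℕ := Nat.card (G.neighborSet u)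

/-- The number of edges `t_r(n)` of the Turán graph `T_r(n)`. -/
noncomputable def turanEdges (r n : ℕ) : ℕ := edgeCount (SimpleGraph.turanGraph n r)

/-- `v 0, ..., v (k-1)` is a 𝔓-sequence in `G`: each `v i` lies in the common
neighbourhood of the previous terms and has maximum degree among the vertices of
that common neighbourhood (for `i = 0`, the common neighbourhood is the whole
vertex set, so `v 0` is a vertex of maximum degree in `G`). -/
def IsPSeq {V : Type*} (G : SimpleGraph V) {k : ℕ} (v : Fin k → V) : Prop :=
  ∀ i : Fin k,
    (∀ j : Fin k, j < i → G.Adj (v j) (v i)) ∧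
    ∀ u : V, (∀ j : Fin k, j < i → G.Adj (v j) u) → deg G u ≤ deg G (v i)

theorem IsPSeq.deg_antitone {V : Type*} {G : SimpleGraph V} {k : ℕ} {v : Fin k → V}
    (hP : IsPSeq G v) {i j : Fin k} (hij : i ≤ j) : deg G (v j) ≤ deg G (v i) :=
  (hP i).2 _ fun l hl => (hP j).1 l (hl.trans_le hij)

open Classical in
/-- Every vertex has degree at most that of the last term, plus the excess degrees of the
terms it is not adjacent to. -/
theorem IsPSeq.deg_le_add_sum {V : Type*} {G : SimpleGraph V} {k : ℕ} {v : Fin k → V}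
    (hP : IsPSeq G v) {l : Fin k} (hl : ∀ i, i ≤ l) (u : V) :
    (deg G u : ℤ) ≤ deg G (v l) +
      ∑ i, if G.Adj (v i) u then 0 else ((deg G (v i) : ℤ) - deg G (v l)) := by
  have hnonneg : ∀ i ∈ (univ : Finset (Fin k)),
      0 ≤ if G.Adj (v i) u then 0 else ((deg G (v i) : ℤ) - deg G (v l)) := by
    intro i _
    have := hP.deg_antitone (hl i)
    split_ifs <;> omega
  by_cases h : ∀ i, G.Adj (v i) u
  · have := (hP l).2 u fun j _ => h j
    have := sum_nonneg hnonneg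
    omega
  · push Not at h
    obtain ⟨i, hi, hmin⟩ := WellFounded.has_min (wellFounded_lt (α := Fin k))
      {i | ¬ G.Adj (v i) u} h
    have hle := (hP i).2 u fun j hj => by
      by_contra hadj
      exact hmin j hadj hj
    have hsum := single_le_sum hnonneg (mem_univ i)
    rw [if_neg hi] at hsum
    omega

theorem deg_eq_degree {V : Type*} [Fintype V] (G : SimpleGraph V) [DecidableRel G.Adj] (u : V) :
    deg G u = G.degree u := by
  rw [deg, Nat.card_eq_fintype_card, SimpleGraph.card_neighborSet_eq_degree]

theorem sum_deg_eq_two_mul_edgeCount {V : Type*} [Fintype V] (G : SimpleGraph V) :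
    ∑ u, deg G u = 2 * edgeCount G := by
  classical
  simp_rw [deg_eq_degree, G.sum_degrees_eq_twice_card_edges, edgeCount, Nat.card_eq_fintype_card,
    SimpleGraph.edgeFinset_card]

open Classical in
theorem sum_ite_adj_zero {V : Type*} [Fintype V] (G : SimpleGraph V) (w : V) (c : ℤ) :
    (∑ u, if G.Adj w u then 0 else c) = (Fintype.card V - deg G w) * c := by
  have hcard : deg G w + #{u | ¬ G.Adj w u} = Fintype.card V := by
    rw [deg_eq_degree, ← G.card_neighborFinset_eq_degree, G.neighborFinset_eq_filter,
      card_filter_add_card_filter_not, card_univ]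
  rw [sum_ite, sum_const_zero, zero_add, sum_const, nsmul_eq_mul, ← hcard]
  push_cast
  ring

/-- If r ≥ 2 and v_1, ..., v_r is a 𝔓-sequence of r terms in a graph G
with n vertices and m edges, then, writing S for the degree sum of the sequence,
2m ≤ n·S − Σ d(v_i)² + d(v_r)·(S − (r−1)·n). -/
theorem pseq_edge_bound (r n m : ℕ) (hr : 2 ≤ r)
    (G : SimpleGraph (Fin n)) (hm : edgeCount G = m)
    (v : Fin r → Fin n) (hP : IsPSeq G v) :
    (2 * m : ℤ) ≤
      n * (∑ i, (deg G (v i) : ℤ)) - (∑ i, (deg G (v i) : ℤ) ^ 2) +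
        (deg G (v ⟨r - 1, by omega⟩) : ℤ) *
          ((∑ i, (deg G (v i) : ℤ)) - (r - 1) * n) := by
  classical
  set l : Fin r := ⟨r - 1, by omega⟩
  have hlast : ∀ i, i ≤ l := fun i => Fin.le_def.2 (Nat.le_sub_one_of_lt i.2)
  have hsum := sum_le_sum fun u (_ : u ∈ univ) => hP.deg_le_add_sum hlast u
  rw [sum_add_distrib, sum_comm] at hsum
  simp_rw [sum_ite_adj_zero] at hsum
  rw [← Nat.cast_sum, sum_deg_eq_two_mul_edgeCount, hm] at hsum
  have hexpand : ∑ i, ((n : ℤ) - deg G (v i)) * (deg G (v i) - deg G (v l)) =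
      n * (∑ i, (deg G (v i) : ℤ)) - (∑ i, (deg G (v i) : ℤ) ^ 2) +
        deg G (v l) * (∑ i, (deg G (v i) : ℤ)) - r * (n * deg G (v l)) := by
    have hconst : (r : ℤ) * (n * deg G (v l)) = ∑ _i : Fin r, (n * deg G (v l) : ℤ) := by simp
    rw [hconst, mul_sum, mul_sum, ← sum_sub_distrib, ← sum_add_distrib, ← sum_sub_distrib]
    exact sum_congr rfl fun i _ => by ring
  simp only [sum_const, card_univ, Fintype.card_fin, nsmul_eq_mul, hexpand] at hsum
  push_cast at hsum
  linarith
end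

section
/- Let r ≥ 2 and n ≥ r be integers, and let G be a simple graph with n vertices and m edges, where m ≥ t_r(n). Then G contains an r-clique R (a set of r pairwise adjacent vertices) with Σ_{u∈R} d(u) ≥ 2·r·m/n. -/
open Finset

/-- The Turán edge count in terms of the quotient `n / r`. -/
theorem two_mul_turanEdges (r n : ℕ) (hr : 0 < r) :
    2 * turanEdges r n + (2 * (n / r) + 1) * n = n ^ 2 + r * ((n / r) * (n / r + 1)) := by
  classical
  have ht : turanEdges r n = #(SimpleGraph.turanGraph n r).edgeFinset := by
    simp [turanEdges, edgeCount, SimpleGraph.edgeFinset, Set.toFinset_card]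
  rw [ht]
  clear ht
  induction n using Nat.strong_induction_on with
  | _ n ih =>
    obtain hlt | hle := lt_or_ge n r
    · have htop : SimpleGraph.turanGraph n r = ⊤ :=
        SimpleGraph.turanGraph_eq_top.2 (Or.inr hlt.le)
      have hc : #(SimpleGraph.turanGraph n r).edgeFinset = n.choose 2 := by
        have := SimpleGraph.card_edgeFinset_top_eq_card_choose_two (V := Fin n)
        simp only [Fintype.card_fin] at this
        rw [← this]
        congr!
      rw [hc, Nat.div_eq_of_lt hlt, Nat.choose_two_right,
        Nat.mul_div_cancel' (Nat.even_mul_pred_self n).two_dvd]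
      cases n with
      | zero => simp
      | succ n => simp; ring
    · obtain ⟨l, rfl⟩ := Nat.exists_eq_add_of_le' hle
      have h := ih l (by omega)
      rw [SimpleGraph.card_edgeFinset_turanGraph_add, Nat.add_div_right _ hr]
      have hc : 2 * r.choose 2 + r = r ^ 2 := by
        rw [Nat.choose_two_right, Nat.mul_div_cancel' (Nat.even_mul_pred_self r).two_dvd]
        cases r with
        | zero => simp
        | succ r => simp; ring
      obtain ⟨p, rfl⟩ := Nat.exists_eq_add_of_le' hr
      simp only [Nat.add_sub_cancel, Nat.succ_eq_add_one] at *
      nlinarith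

/-- Balanced partitions minimise the sum of squares of the part sizes. -/
theorem sq_le_two_mul_turanEdges_add_sum_sq (r n : ℕ) (hr : 0 < r) (k : ℕ → ℕ)
    (hk : ∑ i ∈ range r, k i = n) :
    n ^ 2 ≤ 2 * turanEdges r n + ∑ i ∈ range r, k i ^ 2 := by
  have h := two_mul_turanEdges r n hr
  generalize n / r = q at h
  have hnn : 0 ≤ ∑ i ∈ range r, ((k i : ℤ) - q) * (k i - q - 1) := by
    refine sum_nonneg fun i _ => ?_
    obtain h | h := le_or_gt (k i : ℤ) q
    · nlinarith
    · exact mul_nonneg (by omega) (by omega)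
  have he : ∑ i ∈ range r, ((k i : ℤ) - q) * (k i - q - 1) =
      ∑ i ∈ range r, (k i : ℤ) ^ 2 - (2 * q + 1) * ∑ i ∈ range r, (k i : ℤ) +
        r * (q * (q + 1)) := by
    rw [mul_sum, ← sum_sub_distrib, ← card_range r, ← nsmul_eq_mul, ← sum_const,
      card_range, ← sum_add_distrib]
    exact sum_congr rfl fun i _ => by ring
  zify at h hk ⊢
  rw [he, hk] at hnn
  linarith

/-- A partition with an empty part is not optimal. -/
theorem sq_lt_two_mul_turanEdges_add_sum_sq (r n : ℕ) (hn : r ≤ n) (k : ℕ → ℕ)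
    (hk : ∑ i ∈ range r, k i = n) {a : ℕ} (ha : a < r) (hka : k a = 0) :
    n ^ 2 < 2 * turanEdges r n + ∑ i ∈ range r, k i ^ 2 := by
  obtain ⟨b, hb, hkb⟩ : ∃ b ∈ range r, 2 ≤ k b := by
    by_contra! hcon
    have : ∑ i ∈ range r, k i < ∑ i ∈ range r, 1 :=
      sum_lt_sum (fun i hi => by have := hcon i hi; omega) ⟨a, mem_range.2 ha, by omega⟩
    simp at this
    omega
  have hab : a ≠ b := by rintro rfl; omega
  have hb' : b ∈ (range r).erase a := mem_erase.2 ⟨hab.symm, hb⟩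
  have split (f : ℕ → ℕ) :
      ∑ i ∈ range r, f i = f a + (f b + ∑ i ∈ ((range r).erase a).erase b, f i) := by
    rw [add_sum_erase _ _ hb', add_sum_erase _ _ (mem_range.2 ha)]
  let k' : ℕ → ℕ := fun i => if i = a then 1 else if i = b then k b - 1 else k i
  have hk'a : k' a = 1 := by simp [k']
  have hk'b : k' b = k b - 1 := by simp [k', hab.symm]
  have hk' : ∀ i ∈ ((range r).erase a).erase b, k' i = k i := by
    intro i hi
    simp only [mem_erase] at hi
    simp [k', hi.1, hi.2.1]
  have h := sq_le_two_mul_turanEdges_add_sum_sq r n (by omega) k' (by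
    have e := split k
    rw [split, sum_congr (g := fun i => k i) rfl hk', hk'a, hk'b]
    omega)
  rw [split, sum_congr rfl (fun i hi => by rw [hk' i hi]), hk'a, hk'b] at h
  rw [split, hka]
  obtain ⟨c, hc⟩ := Nat.exists_eq_add_of_le' hkb
  rw [hc] at h ⊢
  simp only [show c + 2 - 1 = c + 1 by omega] at h
  nlinarith

/-- Discrete intermediate values for sums. -/
theorem exists_between_sum_eq {ι : Type*} [DecidableEq ι] (s : Finset ι) (f g : ι → ℕ)
    (hfg : ∀ i ∈ s, f i ≤ g i) (N : ℕ) (hf : ∑ i ∈ s, f i ≤ N) (hg : N ≤ ∑ i ∈ s, g i) :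
    ∃ h : ι → ℕ, (∀ i ∈ s, f i ≤ h i ∧ h i ≤ g i) ∧ ∑ i ∈ s, h i = N := by
  induction N, hf using Nat.le_induction with
  | base => exact ⟨f, fun i hi => ⟨le_rfl, hfg i hi⟩, rfl⟩
  | succ N _ ih =>
    obtain ⟨h, hh, hs⟩ := ih (by omega)
    obtain ⟨i, hi, hlt⟩ := exists_lt_of_sum_lt (s := s) (f := h) (g := g) (by omega)
    refine ⟨Function.update h i (h i + 1), fun j hj => ?_, ?_⟩
    · obtain rfl | hne := eq_or_ne j i
      · have := hh j hj
        simp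
        omega
      · simpa [hne] using hh j hj
    · rw [sum_update_of_mem hi, ← hs, ← add_sum_erase _ _ hi, sdiff_singleton_eq_erase]
      omega

/-- If `2m` is bounded by a weighted sum of the `d i`, with weights `k i ≤ n - d i`
except for the last one, and `m ≥ t_r(n)`, then the `d i` have sum at least `(r - 1) n`. -/
theorem mul_le_sum_of_turanEdges_le (q n m : ℕ) (hn : q + 1 ≤ n) (d k : ℕ → ℕ)
    (hd : ∀ i ≤ q, d q ≤ d i) (hdn : ∀ i ≤ q, d i ≤ n) (hkd : ∀ i < q, k i + d i ≤ n)
    (hk : ∑ i ∈ range (q + 1), k i = n)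
    (hm : 2 * m ≤ ∑ i ∈ range (q + 1), k i * d i) (hmt : turanEdges (q + 1) n ≤ m) :
    q * n ≤ ∑ i ∈ range (q + 1), d i := by
  by_contra! hS
  have hsum : ∑ i ∈ range (q + 1), (n - d i) + ∑ i ∈ range (q + 1), d i = (q + 1) * n := by
    rw [← sum_add_distrib, sum_congr rfl (g := fun _ => n)]
    · simp
    · intro i hi
      have := hdn i (by simpa [Nat.lt_succ_iff] using hi)
      omega
  have hbig : n < ∑ i ∈ range (q + 1), (n - d i) := by nlinarith
  obtain ⟨h, hh, hhs⟩ := exists_between_sum_eq (range (q + 1))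
    (fun i => if i = q then 0 else k i) (fun i => n - d i)
    (by
      intro i hi
      simp only [mem_range] at hi
      split_ifs with hiq
      · omega
      · have := hkd i (by omega)
        omega)
    n
    (by
      rw [← hk]
      refine sum_le_sum fun i _ => ?_
      split_ifs <;> omega)
    hbig.le
  have hshift : ∑ i ∈ range (q + 1), k i * d i ≤ ∑ i ∈ range (q + 1), h i * d i := by
    have hnn : 0 ≤ ∑ i ∈ range (q + 1), ((h i : ℤ) - k i) * (d i - d q) := by
      refine sum_nonneg fun i hi => ?_
      have h1 := (hh i hi).1
      have h2 := hd i (by simpa [Nat.lt_succ_iff] using hi)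
      split_ifs at h1 with hiq
      · simp [hiq]
      · exact mul_nonneg (by omega) (by omega)
    have he : ∑ i ∈ range (q + 1), ((h i : ℤ) - k i) * (d i - d q) =
        ∑ i ∈ range (q + 1), (h i : ℤ) * d i - ∑ i ∈ range (q + 1), (k i : ℤ) * d i -
        ((∑ i ∈ range (q + 1), (h i : ℤ)) - ∑ i ∈ range (q + 1), (k i : ℤ)) * d q := by
      rw [← sum_sub_distrib, ← sum_sub_distrib, sum_mul, ← sum_sub_distrib]
      exact sum_congr rfl fun i _ => by ring
    zify at hk hhs ⊢
    rw [he, hk, hhs] at hnn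
    linarith
  have hle : ∀ i ∈ range (q + 1), h i * d i + h i ^ 2 ≤ h i * n := by
    intro i hi
    have h1 := (hh i hi).2
    have h2 := hdn i (by simpa [Nat.lt_succ_iff] using hi)
    have : h i * (d i + h i) ≤ h i * n := Nat.mul_le_mul_left _ (by omega)
    linarith [this, mul_add (h i) (d i) (h i), sq (h i)]
  have htot : ∑ i ∈ range (q + 1), h i * n = n ^ 2 := by rw [← sum_mul, hhs, sq]
  have hge := sq_le_two_mul_turanEdges_add_sum_sq (q + 1) n (by omega) h hhs
  by_cases hz : ∃ a < q + 1, h a = 0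
  · obtain ⟨a, ha, hza⟩ := hz
    have h1 := sq_lt_two_mul_turanEdges_add_sum_sq (q + 1) n hn h hhs ha hza
    have h2 := sum_le_sum hle
    rw [sum_add_distrib] at h2
    omega
  · push Not at hz
    obtain ⟨i, hi, hlt⟩ := exists_lt_of_sum_lt (hhs.trans_lt hbig)
    have h2 := sum_lt_sum hle ⟨i, hi, by
      have : h i * (d i + h i) < h i * n :=
        Nat.mul_lt_mul_of_pos_left (by omega) (Nat.pos_of_ne_zero (hz i (mem_range.1 hi)))
      linarith [this, mul_add (h i) (d i) (h i), sq (h i)]⟩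
    rw [sum_add_distrib] at h2
    omega

/-- If the `d i` have sum at least `(r - 1) n` then the weighted bound on `2m`
forces their average to be at least `2m / n`. -/
theorem two_mul_mul_le_mul_sum (q n m : ℕ) (d k : ℕ → ℕ)
    (hd : ∀ i ≤ q, d q ≤ d i) (hkd : ∀ i < q, k i + d i ≤ n)
    (hk : ∑ i ∈ range (q + 1), k i = n)
    (hm : 2 * m ≤ ∑ i ∈ range (q + 1), k i * d i)
    (hS : q * n ≤ ∑ i ∈ range (q + 1), d i) :
    2 * (q + 1) * m ≤ n * ∑ i ∈ range (q + 1), d i := by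
  have hnn : 0 ≤ ∑ i ∈ range (q + 1), ((n : ℤ) - d i - k i) * (d i - d q) := by
    refine sum_nonneg fun i hi => ?_
    have h2 := hd i (by simpa [Nat.lt_succ_iff] using hi)
    obtain rfl | hiq := eq_or_ne i q
    · simp
    · have := hkd i (by simp at hi; omega)
      exact mul_nonneg (by omega) (by omega)
  have he : ∑ i ∈ range (q + 1), ((n : ℤ) - d i - k i) * (d i - d q) =
      n * ∑ i ∈ range (q + 1), (d i : ℤ) - ∑ i ∈ range (q + 1), (d i : ℤ) ^ 2 -
        ∑ i ∈ range (q + 1), (k i : ℤ) * d i - (q + 1) * (n * d q) +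
        (∑ i ∈ range (q + 1), (d i : ℤ)) * d q + (∑ i ∈ range (q + 1), (k i : ℤ)) * d q := by
    have hc : ((q : ℤ) + 1) * (n * d q) = ∑ i ∈ range (q + 1), (n * d q : ℤ) := by simp
    rw [hc, mul_sum, sum_mul, sum_mul]
    simp only [← sum_sub_distrib, ← sum_add_distrib]
    exact sum_congr rfl fun i _ => by ring
  have hcs : (∑ i ∈ range (q + 1), (d i : ℤ)) ^ 2 ≤
      (q + 1) * ∑ i ∈ range (q + 1), (d i : ℤ) ^ 2 := by
    simpa using sq_sum_le_card_mul_sum_sq (s := range (q + 1)) (f := fun i => (d i : ℤ))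
  have hmin : (q + 1) * d q ≤ ∑ i ∈ range (q + 1), d i := by
    simpa using card_nsmul_le_sum (range (q + 1)) d (d q)
      fun i hi => hd i (by simpa [Nat.lt_succ_iff] using hi)
  zify at hm hk hS hmin ⊢
  rw [he, hk] at hnn
  have hprod := mul_le_mul_of_nonneg_right hmin (sub_nonneg.2 hS)
  have hnn' := mul_nonneg (by positivity : (0 : ℤ) ≤ q + 1) hnn
  have hm' := mul_le_mul_of_nonneg_left hm (by positivity : (0 : ℤ) ≤ q + 1)
  nlinarith

/-- If r ≥ 2, n ≥ r, and G is a graph with n vertices and m ≥ t_r(n)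
edges, then G contains an r-clique whose degree sum is at least 2·r·m/n. -/
theorem exists_clique_degree_sum_ge_avg (r n m : ℕ) (hr : 2 ≤ r) (hn : r ≤ n)
    (G : SimpleGraph (Fin n)) (hm : edgeCount G = m) (hmt : turanEdges r n ≤ m) :
    ∃ R : Finset (Fin n), G.IsNClique r R ∧
      (2 * r * m : ℝ) / n ≤ ∑ u ∈ R, (deg G u : ℝ) := by
  classical
  obtain ⟨q, rfl⟩ : ∃ q, r = q + 1 := ⟨r - 1, by omega⟩
  have hdeg (u : Fin n) : deg G u = #(G.neighborFinset u) := by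
    simp [deg, SimpleGraph.neighborFinset, Set.toFinset_card]
  have hhand : ∑ u, deg G u = 2 * m := by
    rw [← hm]
    simp only [hdeg, SimpleGraph.card_neighborFinset_eq_degree]
    rw [SimpleGraph.sum_degrees_eq_twice_card_edges]
    simp [edgeCount, SimpleGraph.edgeFinset, Set.toFinset_card]
  have hpick (C : Finset (Fin n)) :
      ∃ w : Fin n, C.Nonempty → w ∈ C ∧ ∀ u ∈ C, deg G u ≤ deg G w := by
    by_cases hC : C.Nonempty
    · obtain ⟨w, hw⟩ := exists_max_image C (deg G) hC
      exact ⟨w, fun _ => hw⟩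
    · exact ⟨⟨0, by omega⟩, fun h => (hC h).elim⟩
  choose w hw using hpick
  -- the greedy sequence `v` and the common neighbourhoods `C i` of its initial segments
  let C : ℕ → Finset (Fin n) := fun i => Nat.rec univ (fun _ D => D ∩ G.neighborFinset (w D)) i
  let v : ℕ → Fin n := fun i => w (C i)
  have hC0 : C 0 = univ := rfl
  have hCs (i : ℕ) : C (i + 1) = C i ∩ G.neighborFinset (v i) := rfl
  have hanti : Antitone C := antitone_nat_of_succ_le fun i => by rw [hCs]; exact inter_subset_left
  have hmax {i : ℕ} {u : Fin n} (hu : u ∈ C i) : deg G u ≤ deg G (v i) := (hw _ ⟨u, hu⟩).2 u hu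
  let k : ℕ → ℕ := fun i => if i = q then #(C q) else #(C i \ C (i + 1))
  have hkq : k q = #(C q) := by simp [k]
  have hk_lt {i : ℕ} (hi : i < q) : k i = #(C i \ C (i + 1)) := by simp [k, hi.ne]
  have hdn (i : ℕ) : deg G (v i) ≤ n := by
    rw [hdeg]
    simpa using card_le_univ (G.neighborFinset (v i))
  have hkd : ∀ i < q, k i + deg G (v i) ≤ n := by
    intro i hi
    rw [hk_lt hi, hdeg, ← card_union_of_disjoint]
    · simpa using card_le_univ (C i \ C (i + 1) ∪ G.neighborFinset (v i))
    · rw [disjoint_left]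
      intro u hu hu'
      rw [mem_sdiff, hCs, mem_inter] at hu
      exact hu.2 ⟨hu.1, hu'⟩
  have hsplit (f : Fin n → ℕ) (j : ℕ) :
      ∑ u, f u = ∑ i ∈ range j, ∑ u ∈ C i \ C (i + 1), f u + ∑ u ∈ C j, f u := by
    induction j with
    | zero => simp [hC0]
    | succ j ih =>
      rw [ih, sum_range_succ, add_assoc, sum_sdiff (hanti (Nat.le_succ j))]
  have hk : ∑ i ∈ range (q + 1), k i = n := by
    have h := hsplit (fun _ => 1) q
    simp only [sum_const, smul_eq_mul, mul_one, card_univ, Fintype.card_fin] at h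
    rw [sum_range_succ, hkq, sum_congr rfl fun i hi => hk_lt (mem_range.1 hi)]
    exact h.symm
  have hweight : 2 * m ≤ ∑ i ∈ range (q + 1), k i * deg G (v i) := by
    rw [← hhand, hsplit _ q, sum_range_succ, hkq]
    refine add_le_add (sum_le_sum fun i hi => ?_) ?_
    · rw [hk_lt (mem_range.1 hi), ← smul_eq_mul]
      exact sum_le_card_nsmul _ _ _ fun u hu => hmax (mem_sdiff.1 hu).1
    · rw [← smul_eq_mul]
      exact sum_le_card_nsmul _ _ _ fun u hu => hmax hu
  have hne : (C q).Nonempty := by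
    rw [nonempty_iff_ne_empty]
    intro hemp
    have hkq0 : k q = 0 := by simp [hkq, hemp]
    have h1 := sq_lt_two_mul_turanEdges_add_sum_sq (q + 1) n hn k hk q.lt_succ_self hkq0
    have h2 : ∑ i ∈ range (q + 1), (k i * deg G (v i) + k i ^ 2) ≤
        ∑ i ∈ range (q + 1), k i * n := by
      refine sum_le_sum fun i hi => ?_
      obtain rfl | hiq := eq_or_ne i q
      · simp [hkq0]
      · have := Nat.mul_le_mul_left (k i) (hkd i (by simp at hi; omega))
        linarith [this, mul_add (k i) (k i) (deg G (v i)), sq (k i)]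
    rw [sum_add_distrib, ← sum_mul, hk, ← sq] at h2
    omega
  have hvC {i : ℕ} (hi : i ≤ q) : v i ∈ C i := (hw _ (hne.mono (hanti hi))).1
  have hadj {i j : ℕ} (hij : i < j) (hj : j ≤ q) : G.Adj (v i) (v j) := by
    have h := hanti (Nat.succ_le_of_lt hij) (hvC hj)
    rw [Nat.succ_eq_add_one, hCs, mem_inter, SimpleGraph.mem_neighborFinset] at h
    exact h.2
  have hd : ∀ i ≤ q, deg G (v q) ≤ deg G (v i) := fun i hi => hmax (hanti hi (hvC le_rfl))
  have hadj' {i j : ℕ} (hi : i ≤ q) (hj : j ≤ q) (hij : i ≠ j) : G.Adj (v i) (v j) := by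
    obtain h | h := hij.lt_or_gt
    · exact hadj h hj
    · exact (hadj h hi).symm
  have hinj : Set.InjOn v (range (q + 1)) := by
    intro i hi j hj hij
    simp only [coe_range, Set.mem_Iio, Nat.lt_succ_iff] at hi hj
    by_contra hne
    exact (hadj' hi hj hne).ne hij
  refine ⟨(range (q + 1)).image v, ⟨?_, ?_⟩, ?_⟩
  · intro x hx y hy hxy
    simp only [coe_image, coe_range, Set.mem_image, Set.mem_Iio, Nat.lt_succ_iff] at hx hy
    obtain ⟨i, hi, rfl⟩ := hx
    obtain ⟨j, hj, rfl⟩ := hy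
    exact hadj' hi hj fun h => hxy (h ▸ rfl)
  · rw [card_image_of_injOn hinj, card_range]
  · rw [sum_image hinj, div_le_iff₀ (by exact_mod_cast (by omega : 0 < n)), mul_comm _ (n : ℝ)]
    exact_mod_cast two_mul_mul_le_mul_sum q n m (fun i => deg G (v i)) k hd hkd hk hweight
      (mul_le_sum_of_turanEdges_le q n m hn (fun i => deg G (v i)) k hd (fun i _ => hdn i)
        hkd hk hweight hmt)
end
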